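/- arXiv:1412.2300 — 4 statements merged into one kernel-verified Lean document; each statement's English description precedes it below -/
import Mathlib

section
/- In the one-sided case, the optimal cost decomposes over the rightmost sensor used: OptCost = min { D(j) : j₀ ≤ j ≤ n }, where j₀ := max(m, ⌈β/(2z)⌉). (This is Lemma 4 of the paper: the optimum equals the minimum over j of the cost D_s(j) of first moving sensors m+1,…,j leftwards to β+z plus the optimal cost OptC(j) of the resulting containing-case instance on the first j sensors.) -/
/-- A configuration `y` of the `n` sensors (with covering range `z`) covers the
barrier `[0, β]`. -/
def Covers (n : ℕ) (z β : ℝ) (y : ℕ → ℝ) : Prop :=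
  Set.Icc (0 : ℝ) β ⊆ ⋃ i ∈ Finset.Icc 1 n, Set.Icc (y i - z) (y i + z)

/-- The cost of moving the sensors from positions `x` to positions `y`. -/
noncomputable def Cost (n : ℕ) (x y : ℕ → ℝ) : ℝ :=
  ∑ i ∈ Finset.Icc 1 n, |x i - y i|

/-- The optimal (infimum) cost over all covering configurations. -/
noncomputable def OptCost (n : ℕ) (z β : ℝ) (x : ℕ → ℝ) : ℝ :=
  sInf {c : ℝ | ∃ y : ℕ → ℝ, Covers n z β y ∧ c = Cost n x y}

/-- One-sided case: the optimal cost `OptC(j)` of the containing-case instance on the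
first `j` sensors, where sensors `m+1, …, j` have been moved to `β + z`. -/
noncomputable def OptC (m : ℕ) (z β : ℝ) (x : ℕ → ℝ) (j : ℕ) : ℝ :=
  sInf {c : ℝ | ∃ y : ℕ → ℝ, Covers j z β y ∧
    c = ∑ i ∈ Finset.Icc 1 j, |(if i ≤ m then x i else β + z) - y i|}

/-- `D(j)`: the cost of moving sensors `m+1, …, j` leftwards to `β + z` plus the
optimal cost of the resulting containing-case instance on the first `j` sensors. -/
noncomputable def DVal (m : ℕ) (z β : ℝ) (x : ℕ → ℝ) (j : ℕ) : ℝ :=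
  (∑ i ∈ Finset.Icc (m + 1) j, (x i - z - β)) + OptC m z β x j

/-- Membership form of `Covers`. -/
theorem covers_iff {n : ℕ} {z β : ℝ} {y : ℕ → ℝ} :
    Covers n z β y ↔ ∀ t, 0 ≤ t → t ≤ β →
      ∃ i, 1 ≤ i ∧ i ≤ n ∧ y i - z ≤ t ∧ t ≤ y i + z := by
  constructor
  · intro h t h0 h1
    have := h ⟨h0, h1⟩
    simp only [Set.mem_iUnion, Finset.mem_Icc, Set.mem_Icc] at this
    obtain ⟨i, ⟨hi1, hi2⟩, hi3, hi4⟩ := this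
    exact ⟨i, hi1, hi2, hi3, hi4⟩
  · rintro h t ⟨h0, h1⟩
    obtain ⟨i, hi1, hi2, hi3, hi4⟩ := h t h0 h1
    simp only [Set.mem_iUnion, Finset.mem_Icc, Set.mem_Icc]
    exact ⟨i, ⟨hi1, hi2⟩, hi3, hi4⟩

/-- A barrier covered by `n` sensors has length at most `2zn`. -/
theorem Covers.length_le {n : ℕ} {z β : ℝ} {y : ℕ → ℝ} (hz : 0 < z) (h : Covers n z β y) :
    β ≤ 2 * z * n := by
  have h1 : MeasureTheory.volume (Set.Icc (0 : ℝ) β) ≤ ENNReal.ofReal (2 * z * n) := by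
    calc MeasureTheory.volume (Set.Icc (0 : ℝ) β)
        ≤ MeasureTheory.volume (⋃ i ∈ Finset.Icc 1 n, Set.Icc (y i - z) (y i + z)) :=
          MeasureTheory.measure_mono h
      _ ≤ ∑ i ∈ Finset.Icc 1 n, MeasureTheory.volume (Set.Icc (y i - z) (y i + z)) :=
          MeasureTheory.measure_biUnion_finset_le _ _
      _ = ∑ i ∈ Finset.Icc 1 n, ENNReal.ofReal (2 * z) := by
          refine Finset.sum_congr rfl fun i _ => ?_
          rw [Real.volume_Icc]
          congr 1
          ring
      _ = ENNReal.ofReal (2 * z * n) := by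
          rw [← ENNReal.ofReal_sum_of_nonneg (fun _ _ => by positivity)]
          simp [mul_comm]
  rw [Real.volume_Icc, sub_zero] at h1
  exact (ENNReal.ofReal_le_ofReal_iff (by positivity)).1 h1

/-- Equally spaced sensors cover any barrier of length at most `2zn`. -/
theorem exists_covers {n : ℕ} {z β : ℝ} (hn : 1 ≤ n) (hz : 0 < z) (h : β ≤ 2 * z * n) :
    ∃ y, Covers n z β y := by
  refine ⟨fun i => (2 * i - 1) * z, covers_iff.2 fun t h0 h1 => ?_⟩
  rcases h0.eq_or_lt with rfl | hpos
  · refine ⟨1, le_rfl, hn, ?_, ?_⟩ <;> norm_num <;> linarith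
  have hq : 0 < t / (2 * z) := by positivity
  have hmul : t / (2 * z) * (2 * z) = t := by field_simp
  have hlt := Nat.ceil_lt_add_one hq.le
  have hle := Nat.le_ceil (t / (2 * z))
  refine ⟨⌈t / (2 * z)⌉₊, Nat.ceil_pos.2 hq, Nat.ceil_le.2 ?_, ?_, ?_⟩
  · rw [div_le_iff₀ (by positivity)]
    linarith
  · nlinarith
  · nlinarith

theorem sum_Icc_one_split (f : ℕ → ℝ) {m j : ℕ} (h : m ≤ j) :
    ∑ i ∈ Finset.Icc 1 j, f i =
      ∑ i ∈ Finset.Icc 1 m, f i + ∑ i ∈ Finset.Icc (m + 1) j, f i := by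
  induction j, h using Nat.le_induction with
  | base => simp
  | succ k hk ih =>
    rw [Finset.sum_Icc_succ_top (by omega), Finset.sum_Icc_succ_top (by omega), ih, add_assoc]

/-- A finite set `U` of naturals above `m` is enumerated by `m + 1, …, m + #U` through a map
that does not decrease any index. -/
theorem exists_enumeration (m : ℕ) (U : Finset ℕ) (hU : ∀ a ∈ U, m < a) :
    ∃ σ : ℕ → ℕ, Set.InjOn σ (Finset.Icc (m + 1) (m + U.card)) ∧
      (Finset.Icc (m + 1) (m + U.card)).image σ = U ∧
      ∀ i ∈ Finset.Icc (m + 1) (m + U.card), i ≤ σ i := by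
  have hcard : ((Finset.univ : Finset (Fin U.card)).image
      (fun t : Fin U.card => m + 1 + t.1)) = Finset.Icc (m + 1) (m + U.card) := by
    ext i
    simp only [Finset.mem_image, Finset.mem_univ, true_and, Finset.mem_Icc]
    constructor
    · rintro ⟨t, rfl⟩
      omega
    · rintro ⟨h1, h2⟩
      exact ⟨⟨i - (m + 1), by omega⟩, by simp; omega⟩
  let e := U.orderEmbOfFin rfl
  have hge : ∀ (t : ℕ) (ht : t < U.card), m + 1 + t ≤ e ⟨t, ht⟩ := by
    intro t
    induction t with
    | zero => exact fun ht => hU _ (U.orderEmbOfFin_mem rfl _)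
    | succ t ih =>
      intro ht
      have h1 := ih (by omega)
      have h2 : e ⟨t, by omega⟩ < e ⟨t + 1, ht⟩ := e.strictMono (by simp)
      omega
  let σ : ℕ → ℕ := fun i => if h : i - (m + 1) < U.card then e ⟨i - (m + 1), h⟩ else 0
  have hσ : ∀ t : Fin U.card, σ (m + 1 + t.1) = e t := by
    intro t
    simp [σ]
  refine ⟨σ, ?_, ?_, ?_⟩
  · rw [← hcard]
    intro a ha b hb hab
    simp only [Finset.coe_image, Finset.coe_univ, Set.image_univ, Set.mem_range] at ha hb
    obtain ⟨s, rfl⟩ := ha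
    obtain ⟨t, rfl⟩ := hb
    rw [hσ, hσ] at hab
    rw [e.injective hab]
  · rw [← hcard, Finset.image_image]
    have : σ ∘ (fun t : Fin U.card => m + 1 + t.1) = e := funext hσ
    rw [this]
    exact U.image_orderEmbOfFin_univ rfl
  · rw [← hcard]
    intro i hi
    obtain ⟨t, -, rfl⟩ := Finset.mem_image.1 hi
    rw [hσ]
    exact hge t.1 t.2

theorem optCost_le {n : ℕ} {z β : ℝ} {x y : ℕ → ℝ} (h : Covers n z β y) :
    OptCost n z β x ≤ Cost n x y := by
  refine csInf_le ⟨0, ?_⟩ ⟨y, h, rfl⟩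
  rintro c ⟨_, -, rfl⟩
  exact Finset.sum_nonneg fun _ _ => abs_nonneg _

theorem optC_le {m j : ℕ} {z β : ℝ} {x y : ℕ → ℝ} (h : Covers j z β y) :
    OptC m z β x j ≤ ∑ i ∈ Finset.Icc 1 j, |(if i ≤ m then x i else β + z) - y i| := by
  refine csInf_le ⟨0, ?_⟩ ⟨y, h, rfl⟩
  rintro c ⟨_, -, rfl⟩
  exact Finset.sum_nonneg fun _ _ => abs_nonneg _

/-- Splitting the objective of the containing-case instance at `m`. -/
theorem sum_modified_eq {m j : ℕ} (hmj : m ≤ j) (b : ℝ) (x y : ℕ → ℝ) :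
    ∑ i ∈ Finset.Icc 1 j, |(if i ≤ m then x i else b) - y i| =
      ∑ i ∈ Finset.Icc 1 m, |x i - y i| + ∑ i ∈ Finset.Icc (m + 1) j, |b - y i| := by
  rw [sum_Icc_one_split _ hmj]
  congr 1 <;> refine Finset.sum_congr rfl fun i hi => ?_ <;> rw [Finset.mem_Icc] at hi
  · rw [if_pos hi.2]
  · rw [if_neg (by omega)]

theorem optCost_le_DVal {n m j : ℕ} {z β : ℝ} {x : ℕ → ℝ} (hz : 0 < z) (hm1 : 1 ≤ m)
    (hmmax : ∀ i, m < i → i ≤ n → β < x i - z) (hmj : m ≤ j) (hjn : j ≤ n)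
    (hj : β ≤ 2 * z * j) : OptCost n z β x ≤ DVal m z β x j := by
  unfold DVal
  rw [← sub_le_iff_le_add']
  obtain ⟨y₀, hy₀⟩ := exists_covers (hm1.trans hmj) hz hj
  refine le_csInf ⟨_, y₀, hy₀, rfl⟩ ?_
  rintro c ⟨y, hy, rfl⟩
  rw [sub_le_iff_le_add', sum_modified_eq hmj]
  have hcov : Covers n z β (fun i => if i ≤ j then y i else x i) := by
    refine covers_iff.2 fun t h0 h1 => ?_
    obtain ⟨i, hi1, hi2, hi⟩ := covers_iff.1 hy t h0 h1
    exact ⟨i, hi1, hi2.trans hjn, by simpa only [if_pos hi2] using hi⟩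
  refine (optCost_le hcov).trans ?_
  unfold Cost
  rw [sum_Icc_one_split _ hjn, sum_Icc_one_split _ hmj]
  have h1 : ∑ i ∈ Finset.Icc 1 m, |x i - if i ≤ j then y i else x i| =
      ∑ i ∈ Finset.Icc 1 m, |x i - y i| := by
    refine Finset.sum_congr rfl fun i hi => ?_
    rw [if_pos ((Finset.mem_Icc.1 hi).2.trans hmj)]
  have h2 : ∑ i ∈ Finset.Icc (j + 1) n, |x i - if i ≤ j then y i else x i| = 0 := by
    refine Finset.sum_eq_zero fun i hi => ?_
    rw [if_neg (by have := (Finset.mem_Icc.1 hi).1; omega), sub_self, abs_zero]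
  have h3 : ∑ i ∈ Finset.Icc (m + 1) j, |x i - if i ≤ j then y i else x i| ≤
      ∑ i ∈ Finset.Icc (m + 1) j, (x i - z - β) +
        ∑ i ∈ Finset.Icc (m + 1) j, |β + z - y i| := by
    rw [← Finset.sum_add_distrib]
    refine Finset.sum_le_sum fun i hi => ?_
    rw [Finset.mem_Icc] at hi
    rw [if_pos hi.2]
    have hx := hmmax i (by omega) (hi.2.trans hjn)
    have habs := abs_sub_le (x i) (β + z) (y i)
    rw [abs_of_pos (show 0 < x i - (β + z) by linarith)] at habs
    linarith
  linarith

/-- Every covering configuration costs at least `D(j)` for some admissible `j`: sensors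
`m + 1, …, j` take over the positions of the sensors beyond `m` that reach the barrier. -/
theorem exists_DVal_le_cost {n m : ℕ} {z β : ℝ} {x y : ℕ → ℝ} (hz : 0 < z)
    (hsort : ∀ i, 1 ≤ i → i < n → x i ≤ x (i + 1)) (hmn : m ≤ n)
    (hy : Covers n z β y) :
    ∃ j, m ≤ j ∧ j ≤ n ∧ β ≤ 2 * z * j ∧ DVal m z β x j ≤ Cost n x y := by
  have hmono : ∀ a b, 1 ≤ a → a ≤ b → b ≤ n → x a ≤ x b := by
    intro a b ha hab
    induction b, hab using Nat.le_induction with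
    | base => exact fun _ => le_rfl
    | succ k hk ih => exact fun hkn => (ih (by omega)).trans (hsort k (by omega) (by omega))
  set U := (Finset.Icc (m + 1) n).filter (fun i => y i ≤ β + z)
  have hUsub : U ⊆ Finset.Icc (m + 1) n := Finset.filter_subset _ _
  have hUcard : m + U.card ≤ n := by
    have := Finset.card_le_card hUsub
    rw [Nat.card_Icc] at this
    omega
  obtain ⟨σ, hinj, himg, hle⟩ :=
    exists_enumeration m U fun a ha => (Finset.mem_Icc.1 (hUsub ha)).1
  have hcov : Covers (m + U.card) z β (fun i => if i ≤ m then y i else y (σ i)) := by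
    refine covers_iff.2 fun t h0 h1 => ?_
    obtain ⟨i, hi1, hi2, hi3, hi4⟩ := covers_iff.1 hy t h0 h1
    by_cases him : i ≤ m
    · exact ⟨i, hi1, by omega, by simpa only [if_pos him] using ⟨hi3, hi4⟩⟩
    · have hiU : i ∈ U :=
        Finset.mem_filter.2 ⟨Finset.mem_Icc.2 ⟨by omega, hi2⟩, by linarith⟩
      rw [← himg] at hiU
      obtain ⟨k, hk, rfl⟩ := Finset.mem_image.1 hiU
      rw [Finset.mem_Icc] at hk
      refine ⟨k, by omega, hk.2, ?_⟩
      simpa only [if_neg (show ¬ k ≤ m by omega)] using ⟨hi3, hi4⟩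
  refine ⟨m + U.card, Nat.le_add_right _ _, hUcard, hcov.length_le hz, ?_⟩
  have hD := optC_le (m := m) (x := x) hcov
  rw [sum_modified_eq (Nat.le_add_right _ _)] at hD
  have h1 : ∑ i ∈ Finset.Icc 1 m, |x i - if i ≤ m then y i else y (σ i)| =
      ∑ i ∈ Finset.Icc 1 m, |x i - y i| := by
    refine Finset.sum_congr rfl fun i hi => ?_
    rw [if_pos (Finset.mem_Icc.1 hi).2]
  have h2 : ∑ i ∈ Finset.Icc (m + 1) (m + U.card), (x i - z - β) +
      ∑ i ∈ Finset.Icc (m + 1) (m + U.card), |β + z - if i ≤ m then y i else y (σ i)| ≤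
      ∑ i ∈ Finset.Icc (m + 1) n, |x i - y i| := by
    calc _ ≤ ∑ i ∈ Finset.Icc (m + 1) (m + U.card), |x (σ i) - y (σ i)| := by
          rw [← Finset.sum_add_distrib]
          refine Finset.sum_le_sum fun i hi => ?_
          have hσU : σ i ∈ U := himg ▸ Finset.mem_image_of_mem σ hi
          have hσy := (Finset.mem_filter.1 hσU).2
          have hσn := (Finset.mem_Icc.1 (hUsub hσU)).2
          have hiσ := hle i hi
          rw [Finset.mem_Icc] at hi
          have hxi := hmono i (σ i) (by omega) hiσ hσn
          rw [if_neg (by omega), abs_of_nonneg (by linarith)]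
          linarith [le_abs_self (x (σ i) - y (σ i))]
      _ = ∑ i ∈ U, |x i - y i| := by
          rw [← Finset.sum_image (f := fun i => |x i - y i|) hinj, himg]
      _ ≤ _ := Finset.sum_le_sum_of_subset_of_nonneg hUsub fun _ _ _ => abs_nonneg _
  unfold DVal Cost
  rw [sum_Icc_one_split _ hmn]
  linarith

/-- Lemma 4: in the one-sided case, `OptCost = min { D(j) : j₀ ≤ j ≤ n }` where
`j₀ = max(m, ⌈β/(2z)⌉)`. -/
theorem one_sided_opt_eq_min_D
    (n : ℕ) (z β : ℝ) (x : ℕ → ℝ) (m : ℕ)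
    (hn : 1 ≤ n) (hz : 0 < z) (hβ : 0 < β)
    (hsort : ∀ i, 1 ≤ i → i < n → x i ≤ x (i + 1))
    (hx1l : -z ≤ x 1) (hx1r : x 1 - z ≤ β) (hfeas : β ≤ 2 * z * n)
    (hm1 : 1 ≤ m) (hmn : m < n)
    (hmle : x m - z ≤ β)
    (hmmax : ∀ i, m < i → i ≤ n → β < x i - z) :
    OptCost n z β x =
      sInf {d : ℝ | ∃ j : ℕ, max m ⌈β / (2 * z)⌉₊ ≤ j ∧ j ≤ n ∧ d = DVal m z β x j} := by
  have hj₀ : ∀ j : ℕ, max m ⌈β / (2 * z)⌉₊ ≤ j ↔ m ≤ j ∧ β ≤ 2 * z * j := by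
    intro j
    rw [max_le_iff, Nat.ceil_le, div_le_iff₀ (by positivity), mul_comm (j : ℝ)]
  have hlower : ∀ d ∈ {d : ℝ | ∃ j : ℕ, max m ⌈β / (2 * z)⌉₊ ≤ j ∧ j ≤ n ∧
      d = DVal m z β x j}, OptCost n z β x ≤ d := by
    rintro d ⟨j, hj, hjn, rfl⟩
    exact optCost_le_DVal hz hm1 hmmax ((hj₀ j).1 hj).1 hjn ((hj₀ j).1 hj).2
  apply le_antisymm
  · exact le_csInf ⟨_, n, (hj₀ n).2 ⟨hmn.le, hfeas⟩, le_rfl, rfl⟩ hlower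
  · obtain ⟨y₀, hy₀⟩ := exists_covers hn hz hfeas
    refine le_csInf ⟨_, y₀, hy₀, rfl⟩ ?_
    rintro c ⟨y, hy, rfl⟩
    obtain ⟨j, hmj, hjn, hj, hle⟩ := exists_DVal_le_cost hz hsort hmn.le hy
    exact (csInf_le ⟨_, hlower⟩ ⟨j, (hj₀ j).2 ⟨hmj, hj⟩, hjn, rfl⟩).trans hle
end

section
/- In the general case, if r − l + 1 ≥ λ (i.e., at least λ sensor intervals intersect the barrier), then the row and column minimizers of D are constant (Lemma 10 of the paper): there exist l* ∈ [1, l] and r* ∈ [r, n] with D(l*, r*) = OptCost such that for every i ∈ [1, l], r* is the smallest index j ∈ [r, n] minimizing D(i, j), and for every j ∈ [r, n], l* is the smallest index i ∈ [1, l] minimizing D(i, j). (All pairs (i, j) with 1 ≤ i ≤ l and r ≤ j ≤ n satisfy j − i + 1 ≥ r − l + 1 ≥ λ here.) -/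
/-- General case: the modified positions `x^{(i,j)}` where sensors left of `l` are
moved to `-z` and sensors right of `r` are moved to `β + z`. -/
noncomputable def XMod (x : ℕ → ℝ) (l r : ℕ) (z β : ℝ) (t : ℕ) : ℝ :=
  if t < l then -z else if t ≤ r then x t else β + z

/-- General case: the optimal cost `OptC(i,j)` of the containing-case instance on
sensors `i, …, j` with modified positions `x^{(i,j)}`. -/
noncomputable def OptCG (z β : ℝ) (x : ℕ → ℝ) (l r i j : ℕ) : ℝ :=
  sInf {c : ℝ | ∃ y : ℕ → ℝ,
    (Set.Icc (0 : ℝ) β ⊆ ⋃ t ∈ Finset.Icc i j, Set.Icc (y t - z) (y t + z)) ∧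
    c = ∑ t ∈ Finset.Icc i j, |XMod x l r z β t - y t|}

/-- General case: `D(i,j)`, the cost of the manual movements plus the optimal cost of
the resulting containing-case instance on sensors `i, …, j`. -/
noncomputable def DG (z β : ℝ) (x : ℕ → ℝ) (l r i j : ℕ) : ℝ :=
  (∑ t ∈ Finset.Icc i (l - 1), (-z - x t)) +
    (∑ t ∈ Finset.Icc (r + 1) j, (x t - z - β)) + OptCG z β x l r i j

/-- The sensors `i, …, j`, placed at `y`, cover the barrier `[0, β]`. -/
def CoversOn (z β : ℝ) (i j : ℕ) (y : ℕ → ℝ) : Prop :=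
  Set.Icc (0 : ℝ) β ⊆ ⋃ t ∈ Finset.Icc i j, Set.Icc (y t - z) (y t + z)

/-- The cost of moving the sensors `i, …, j` from `X` to `y`. -/
noncomputable def costOn (X : ℕ → ℝ) (i j : ℕ) (y : ℕ → ℝ) : ℝ :=
  ∑ t ∈ Finset.Icc i j, |X t - y t|

/-- The infimum of the cost of covering the barrier with the sensors `i, …, j`. -/
noncomputable def optOn (z β : ℝ) (X : ℕ → ℝ) (i j : ℕ) : ℝ :=
  sInf {c : ℝ | ∃ y : ℕ → ℝ, CoversOn z β i j y ∧ c = costOn X i j y}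

/-- Consecutive sensors leave no gap, the first one covers `0` from the left and the last one
covers `β` from the right. -/
def IsCoverChain (z β : ℝ) (i j : ℕ) (y : ℕ → ℝ) : Prop :=
  y i ≤ z ∧ β - z ≤ y j ∧ ∀ t, i ≤ t → t < j → y (t + 1) - y t ≤ 2 * z

lemma coversOn_iff {z β : ℝ} {i j : ℕ} {y : ℕ → ℝ} :
    CoversOn z β i j y ↔
      ∀ p, 0 ≤ p → p ≤ β → ∃ t, i ≤ t ∧ t ≤ j ∧ y t - z ≤ p ∧ p ≤ y t + z := by
  simp only [CoversOn, Set.subset_def, Set.mem_iUnion, Set.mem_Icc, Finset.mem_Icc]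
  constructor
  · intro h p hp hq
    obtain ⟨t, ⟨h1, h2⟩, h3, h4⟩ := h p ⟨hp, hq⟩
    exact ⟨t, h1, h2, h3, h4⟩
  · rintro h p ⟨hp, hq⟩
    obtain ⟨t, h1, h2, h3, h4⟩ := h p hp hq
    exact ⟨t, ⟨h1, h2⟩, h3, h4⟩

lemma sum_Icc_eq_sum_range_ite (f : ℕ → ℝ) {i j N : ℕ} (h : j < N) :
    ∑ t ∈ Finset.Icc i j, f t = ∑ t ∈ Finset.range N, if i ≤ t ∧ t ≤ j then f t else 0 := by
  rw [← Finset.sum_filter]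
  congr 1
  ext t
  simp only [Finset.mem_Icc, Finset.mem_filter, Finset.mem_range]
  omega

lemma costOn_nonneg (X : ℕ → ℝ) (i j : ℕ) (y : ℕ → ℝ) : 0 ≤ costOn X i j y :=
  Finset.sum_nonneg fun _ _ => abs_nonneg _

lemma optOn_le {z β : ℝ} {X : ℕ → ℝ} {i j : ℕ} {y : ℕ → ℝ} (h : CoversOn z β i j y) :
    optOn z β X i j ≤ costOn X i j y := by
  refine csInf_le ⟨0, ?_⟩ ⟨y, h, rfl⟩
  rintro c ⟨y, -, rfl⟩
  exact costOn_nonneg X i j y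

lemma le_optOn {z β : ℝ} {X : ℕ → ℝ} {i j : ℕ} {c : ℝ} (hne : ∃ y, CoversOn z β i j y)
    (h : ∀ y, CoversOn z β i j y → c ≤ costOn X i j y) : c ≤ optOn z β X i j := by
  obtain ⟨y, hy⟩ := hne
  refine le_csInf ⟨_, y, hy, rfl⟩ ?_
  rintro _ ⟨y, hy, rfl⟩
  exact h y hy

lemma IsCoverChain.coversOn {z β : ℝ} {i j : ℕ} {y : ℕ → ℝ} (hij : i ≤ j)
    (h : IsCoverChain z β i j y) : CoversOn z β i j y := by
  classical
  obtain ⟨h0, h1, h2⟩ := h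
  rw [coversOn_iff]
  intro p hp hq
  have hex : ∃ t, i ≤ t ∧ p ≤ y t + z := ⟨j, hij, by linarith⟩
  obtain ⟨ht1, ht2⟩ := Nat.find_spec hex
  have hmin : ∀ s, i ≤ s → s < Nat.find hex → y s + z < p := fun s hs hlt => by
    by_contra hc
    exact Nat.find_min hex hlt ⟨hs, not_lt.mp hc⟩
  have htj : Nat.find hex ≤ j := Nat.find_min' hex ⟨hij, by linarith⟩
  generalize Nat.find hex = t at *
  refine ⟨t, ht1, htj, ?_, ht2⟩
  rcases Nat.eq_or_lt_of_le ht1 with rfl | hlt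
  · linarith
  · obtain ⟨s, rfl⟩ : ∃ s, t = s + 1 := ⟨t - 1, by omega⟩
    have := hmin s (by omega) (by omega)
    have := h2 s (by omega) (by omega)
    linarith

lemma abs_sub_add_abs_sub_swap_le {a b c d : ℝ} (hab : a ≤ b) (hcd : c ≤ d) :
    |a - c| + |b - d| ≤ |a - d| + |b - c| := by
  rcases abs_cases (a - c) with h1 | h1 <;> rcases abs_cases (b - d) with h2 | h2 <;>
  rcases abs_cases (a - d) with h3 | h3 <;> rcases abs_cases (b - c) with h4 | h4 <;> linarith

/-- Sorting the target positions does not increase the cost when the sources are sorted. -/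
lemma exists_monotoneOn_costOn_le {X : ℕ → ℝ} {i : ℕ} (j : ℕ) (hij : i ≤ j) (y : ℕ → ℝ)
    (hX : MonotoneOn X (Set.Icc i j)) :
    ∃ y' : ℕ → ℝ, MonotoneOn y' (Set.Icc i j) ∧ y' '' Set.Icc i j = y '' Set.Icc i j ∧
      costOn X i j y' ≤ costOn X i j y := by
  induction j, hij using Nat.le_induction generalizing y with
  | base => exact ⟨y, by simp, rfl, le_rfl⟩
  | succ j hij ih =>
    obtain ⟨p, hp, hmax⟩ := Finset.exists_max_image (Finset.Icc i (j + 1)) y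
      ⟨i, by simp; omega⟩
    rw [Finset.mem_Icc] at hp
    simp only [Finset.mem_Icc] at hmax
    set w : ℕ → ℝ := fun t => y (Equiv.swap p (j + 1) t) with hw
    have hmaps : ∀ t, t ∈ Set.Icc i (j + 1) → Equiv.swap p (j + 1) t ∈ Set.Icc i (j + 1) := by
      intro t ht
      simp only [Set.mem_Icc] at ht ⊢
      rw [Equiv.swap_apply_def]
      split_ifs <;> omega
    have hwimg : w '' Set.Icc i (j + 1) = y '' Set.Icc i (j + 1) := by
      ext v
      constructor
      · rintro ⟨t, ht, rfl⟩
        exact ⟨_, hmaps t ht, rfl⟩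
      · rintro ⟨t, ht, rfl⟩
        exact ⟨_, hmaps t ht, by simp [hw]⟩
    have hwmax : ∀ t, i ≤ t → t ≤ j + 1 → w t ≤ w (j + 1) := by
      intro t h1 h2
      have := hmaps t ⟨h1, h2⟩
      simpa [hw] using hmax _ this
    have hwcost : costOn X i (j + 1) w ≤ costOn X i (j + 1) y := by
      rcases eq_or_ne p (j + 1) with rfl | hne
      · simp [hw]
      · have hpmem : p ∈ Finset.Icc i j := by rw [Finset.mem_Icc]; omega
        unfold costOn
        rw [Finset.sum_Icc_succ_top (by omega), Finset.sum_Icc_succ_top (by omega),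
          ← Finset.add_sum_erase _ _ hpmem, ← Finset.add_sum_erase _ _ hpmem]
        have hrest : ∑ t ∈ (Finset.Icc i j).erase p, |X t - w t|
            = ∑ t ∈ (Finset.Icc i j).erase p, |X t - y t| := by
          refine Finset.sum_congr rfl fun t ht => ?_
          rw [Finset.mem_erase, Finset.mem_Icc] at ht
          rw [hw]
          simp only
          rw [Equiv.swap_apply_of_ne_of_ne ht.1 (by omega)]
        have hXle : X p ≤ X (j + 1) := hX ⟨hp.1, hp.2⟩ ⟨by omega, le_rfl⟩ hp.2
        have := abs_sub_add_abs_sub_swap_le hXle (hmax (j + 1) ⟨by omega, le_rfl⟩)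
        have e1 : w p = y (j + 1) := by simp [hw]
        have e2 : w (j + 1) = y p := by simp [hw]
        rw [hrest, e1, e2]
        linarith
    obtain ⟨u, hu, huimg, hucost⟩ := ih w (hX.mono (Set.Icc_subset_Icc le_rfl (Nat.le_succ j)))
    have hule : ∀ t, i ≤ t → t ≤ j → u t ≤ w (j + 1) := by
      intro t h1 h2
      have : u t ∈ w '' Set.Icc i j := huimg ▸ Set.mem_image_of_mem u ⟨h1, h2⟩
      obtain ⟨s, hs, hs'⟩ := this
      rw [← hs']
      exact hwmax s hs.1 (Nat.le_succ_of_le hs.2)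
    set v : ℕ → ℝ := fun t => if t ≤ j then u t else w (j + 1) with hv
    have hvtop : v (j + 1) = w (j + 1) := by simp [hv]
    have hvu : ∀ t, t ≤ j → v t = u t := fun t ht => by simp [hv, ht]
    refine ⟨v, ?_, ?_, ?_⟩
    · intro s hs t ht hst
      simp only [Set.mem_Icc] at hs ht
      by_cases htj : t ≤ j
      · rw [hvu s (by omega), hvu t htj]
        exact hu ⟨hs.1, by omega⟩ ⟨ht.1, htj⟩ hst
      · obtain rfl : t = j + 1 := by omega
        rw [hvtop]
        by_cases hsj : s ≤ j
        · rw [hvu s hsj]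
          exact hule s hs.1 hsj
        · obtain rfl : s = j + 1 := by omega
          rw [hvtop]
    · rw [← hwimg]
      have hIcc : Set.Icc i (j + 1) = insert (j + 1) (Set.Icc i j) := by
        ext t
        simp only [Set.mem_Icc, Set.mem_insert_iff]
        omega
      rw [hIcc, Set.image_insert_eq, Set.image_insert_eq, hvtop, ← huimg]
      congr 1
      exact Set.image_congr fun t ht => hvu t ht.2
    · refine le_trans ?_ hwcost
      unfold costOn at hucost ⊢
      rw [Finset.sum_Icc_succ_top (by omega), Finset.sum_Icc_succ_top (by omega), hvtop]
      have : ∑ t ∈ Finset.Icc i j, |X t - v t| = ∑ t ∈ Finset.Icc i j, |X t - u t| :=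
        Finset.sum_congr rfl fun t ht => by rw [hvu t (Finset.mem_Icc.mp ht).2]
      linarith

lemma CoversOn.of_image_eq {z β : ℝ} {i j : ℕ} {y y' : ℕ → ℝ} (h : CoversOn z β i j y)
    (himg : y' '' Set.Icc i j = y '' Set.Icc i j) : CoversOn z β i j y' := by
  rw [coversOn_iff] at h ⊢
  intro p hp hq
  obtain ⟨t, h1, h2, h3, h4⟩ := h p hp hq
  have : y t ∈ y' '' Set.Icc i j := himg ▸ Set.mem_image_of_mem y ⟨h1, h2⟩
  obtain ⟨s, hs, hs'⟩ := this
  exact ⟨s, hs.1, hs.2, by rw [hs']; exact h3, by rw [hs']; exact h4⟩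

/-- When the sensors start sorted and touching the barrier, every covering configuration can be
replaced by a chain of no larger cost. -/
lemma CoversOn.exists_isCoverChain {z β : ℝ} {X : ℕ → ℝ} {i j : ℕ} {y : ℕ → ℝ} (hz : 0 < z)
    (hβ : 0 < β) (hij : i ≤ j) (hX : MonotoneOn X (Set.Icc i j))
    (hXmem : ∀ t, i ≤ t → t ≤ j → X t ∈ Set.Icc (-z) (β + z)) (h : CoversOn z β i j y) :
    ∃ y', IsCoverChain z β i j y' ∧ costOn X i j y' ≤ costOn X i j y := by
  set w : ℕ → ℝ := fun t => max (-z) (min (β + z) (y t)) with hw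
  have hwmem : ∀ t, -z ≤ w t ∧ w t ≤ β + z := fun t =>
    ⟨le_max_left _ _, max_le (by linarith) (min_le_left _ _)⟩
  have hwcov : CoversOn z β i j w := by
    rw [coversOn_iff] at h ⊢
    intro p hp hq
    obtain ⟨t, h1, h2, h3, h4⟩ := h p hp hq
    have : w t = y t := by
      simp only [hw]
      rw [min_eq_right (by linarith), max_eq_right (by linarith)]
    exact ⟨t, h1, h2, by rw [this]; exact h3, by rw [this]; exact h4⟩
  have hwcost : costOn X i j w ≤ costOn X i j y := by
    refine Finset.sum_le_sum fun t ht => ?_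
    rw [Finset.mem_Icc] at ht
    obtain ⟨hlo, hhi⟩ := hXmem t ht.1 ht.2
    simp only [hw]
    rcases max_cases (-z) (min (β + z) (y t)) with h1 | h1 <;>
    rcases min_cases (β + z) (y t) with h2 | h2 <;>
    rcases abs_cases (X t - max (-z) (min (β + z) (y t))) with h3 | h3 <;>
    rcases abs_cases (X t - y t) with h4 | h4 <;> linarith
  obtain ⟨v, hv, hvimg, hvcost⟩ := exists_monotoneOn_costOn_le j hij w hX
  have hvcov := coversOn_iff.mp (hwcov.of_image_eq hvimg)
  have hvmem : ∀ t, i ≤ t → t ≤ j → -z ≤ v t ∧ v t ≤ β + z := by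
    intro t h1 h2
    have : v t ∈ w '' Set.Icc i j := hvimg ▸ Set.mem_image_of_mem v ⟨h1, h2⟩
    obtain ⟨s, -, hs⟩ := this
    rw [← hs]
    exact hwmem s
  refine ⟨v, ⟨?_, ?_, ?_⟩, hvcost.trans hwcost⟩
  · obtain ⟨t, h1, h2, h3, -⟩ := hvcov 0 le_rfl hβ.le
    have := hv ⟨le_rfl, hij⟩ ⟨h1, h2⟩ h1
    linarith
  · obtain ⟨t, h1, h2, -, h4⟩ := hvcov β hβ.le le_rfl
    have := hv ⟨h1, h2⟩ ⟨hij, le_rfl⟩ h2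
    linarith
  · intro t h1 h2
    by_contra hgap
    have ha := hvmem t h1 h2.le
    have hb := hvmem (t + 1) (by omega) h2
    obtain ⟨s, g1, g2, g3, g4⟩ := hvcov ((v t + v (t + 1)) / 2) (by linarith) (by linarith)
    rcases Nat.lt_or_ge t s with hts | hts
    · have := hv ⟨by omega, h2⟩ ⟨g1, g2⟩ hts
      linarith
    · have := hv ⟨g1, g2⟩ ⟨h1, h2.le⟩ hts
      linarith

/-- Using more sensors never costs more. -/
lemma CoversOn.optOn_le_of_subset {z β : ℝ} {X : ℕ → ℝ} {i j i' j' : ℕ} {y : ℕ → ℝ}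
    (h : CoversOn z β i j y) (hi : i' ≤ i) (hj : j ≤ j') :
    optOn z β X i' j' ≤ costOn X i j y := by
  set w : ℕ → ℝ := fun t => if i ≤ t ∧ t ≤ j then y t else X t with hw
  have hcov : CoversOn z β i' j' w := by
    rw [coversOn_iff] at h ⊢
    intro p hp hq
    obtain ⟨t, h1, h2, h3, h4⟩ := h p hp hq
    refine ⟨t, by omega, by omega, ?_⟩
    simp only [hw, h1, h2, and_self, if_true]
    exact ⟨h3, h4⟩
  refine (optOn_le hcov).trans ?_
  unfold costOn
  rw [sum_Icc_eq_sum_range_ite _ (Nat.lt_succ_self j'),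
    sum_Icc_eq_sum_range_ite _ (Nat.lt_succ_of_le hj)]
  refine Finset.sum_le_sum fun t _ => ?_
  simp only [hw]
  split_ifs <;> first | omega | simp

lemma costOn_le_of_subset (X : ℕ → ℝ) {i j i' j' : ℕ} (y : ℕ → ℝ) (hi : i' ≤ i) (hj : j ≤ j') :
    costOn X i j y ≤ costOn X i' j' y :=
  Finset.sum_le_sum_of_subset_of_nonneg (Finset.Icc_subset_Icc hi hj) fun _ _ _ => abs_nonneg _

/-- Two chains that cross can exchange their tails. -/
lemma optOn_add_optOn_le_of_cross {z β : ℝ} {X : ℕ → ℝ} {i j i' j' t : ℕ} {y y' : ℕ → ℝ}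
    (h : IsCoverChain z β i j y) (h' : IsCoverChain z β i' j' y')
    (hi : i ≤ t) (hi' : i' ≤ t) (hj : t < j) (hj' : t < j')
    (hle : y' t ≤ y t) (hge : y (t + 1) ≤ y' (t + 1)) :
    optOn z β X i j' + optOn z β X i' j ≤ costOn X i j y + costOn X i' j' y' := by
  have splice : ∀ {a b a' b' : ℕ} {u u' : ℕ → ℝ}, IsCoverChain z β a b u →
      IsCoverChain z β a' b' u' → a ≤ t → a' ≤ t → t < b → t < b' → u' (t + 1) - u t ≤ 2 * z →
      CoversOn z β a b' fun s => if s ≤ t then u s else u' s := by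
    rintro a b a' b' u u' ⟨hu1, -, hu3⟩ ⟨-, hu2', hu3'⟩ ha ha' hb hb' hstep
    refine IsCoverChain.coversOn (by omega) ⟨?_, ?_, ?_⟩
    · simpa [ha] using hu1
    · simpa [not_le.mpr hb'] using hu2'
    · intro s hs hs'
      rcases lt_trichotomy s t with hst | rfl | hst
      · simpa [hst.le, Nat.succ_le_of_lt hst] using hu3 s hs (by omega)
      · simpa using hstep
      · have h1 : ¬ s ≤ t := by omega
        have h2 : ¬ s + 1 ≤ t := by omega
        simpa [h1, h2] using hu3' s (by omega) hs'
  have hs := h.2.2 t hi hj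
  have hs' := h'.2.2 t hi' hj'
  have c1 := optOn_le (X := X) (splice h h' hi hi' hj hj' (by linarith))
  have c2 := optOn_le (X := X) (splice h' h hi' hi hj' hj (by linarith))
  refine (add_le_add c1 c2).trans ?_
  unfold costOn
  have hN : j < j + j' + 1 := by omega
  have hN' : j' < j + j' + 1 := by omega
  rw [sum_Icc_eq_sum_range_ite _ hN, sum_Icc_eq_sum_range_ite _ hN,
    sum_Icc_eq_sum_range_ite _ hN', sum_Icc_eq_sum_range_ite _ hN',
    ← Finset.sum_add_distrib, ← Finset.sum_add_distrib]
  refine Finset.sum_le_sum fun s _ => ?_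
  dsimp only
  split_ifs <;> first | omega | linarith

lemma exists_cross {y y' : ℕ → ℝ} {l q : ℕ} (hlq : l ≤ q) (hl : y' l < y l) (hq : y q ≤ y' q) :
    ∃ t, l ≤ t ∧ t < q ∧ y' t ≤ y t ∧ y (t + 1) ≤ y' (t + 1) := by
  induction q, hlq using Nat.le_induction with
  | base => exact absurd hl (not_lt.mpr hq)
  | succ q hlq ih =>
    by_cases h : y q ≤ y' q
    · obtain ⟨t, h1, h2, h3⟩ := ih h
      exact ⟨t, h1, by omega, h3⟩
    · exact ⟨q, hlq, by omega, (not_le.mp h).le, hq⟩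

lemma optOn_add_optOn_le_of_outer_inner {z β : ℝ} {X : ℕ → ℝ} {l r i j : ℕ} {y y' : ℕ → ℝ}
    (hil : i ≤ l) (hlr : l ≤ r) (hrj : r ≤ j)
    (h : IsCoverChain z β i j y) (h' : IsCoverChain z β l r y') :
    optOn z β X i r + optOn z β X l j ≤ costOn X i j y + costOn X l r y' := by
  by_cases hl : y l ≤ z
  · have hc : IsCoverChain z β l j y := ⟨hl, h.2.1, fun t h1 h2 => h.2.2 t (by omega) h2⟩
    have e1 := optOn_le (X := X) (hc.coversOn (by omega))
    have e2 := costOn_le_of_subset X y hil (le_refl j)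
    have e3 := (h'.coversOn hlr).optOn_le_of_subset (X := X) hil (le_refl r)
    linarith
  by_cases hr : β - z ≤ y r
  · have hc : IsCoverChain z β i r y := ⟨h.1, hr, fun t h1 h2 => h.2.2 t h1 (by omega)⟩
    have e1 := optOn_le (X := X) (hc.coversOn (by omega))
    have e2 := costOn_le_of_subset X y (le_refl i) hrj
    have e3 := (h'.coversOn hlr).optOn_le_of_subset (X := X) (le_refl l) hrj
    linarith
  have a1 := h'.1
  have a2 := h'.2.1
  obtain ⟨t, h1, h2, h3, h4⟩ := exists_cross (y := y) (y' := y') hlr (by linarith) (by linarith)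
  exact optOn_add_optOn_le_of_cross h h' (by omega) h1 (by omega) h2 h3 h4

lemma abs_sub_add_abs_sub_le_of_mem_Icc {a b b' c : ℝ} (h1 : b' ≤ c) (h2 : c ≤ b) :
    |a - (b + b' - c)| + |a - c| ≤ |a - b| + |a - b'| := by
  rcases abs_cases (a - (b + b' - c)) with g1 | g1 <;> rcases abs_cases (a - c) with g2 | g2 <;>
  rcases abs_cases (a - b) with g3 | g3 <;> rcases abs_cases (a - b') with g4 | g4 <;> linarith

lemma optOn_add_optOn_le_of_left_right {z β : ℝ} {X : ℕ → ℝ} {l r i j : ℕ} {y y' : ℕ → ℝ}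
    (hil : i ≤ l) (hlr : l ≤ r) (hrj : r ≤ j) (hlam : β ≤ 2 * z * ((r : ℝ) - l + 1))
    (h : IsCoverChain z β i r y) (h' : IsCoverChain z β l j y') :
    optOn z β X i j + optOn z β X l r ≤ costOn X i r y + costOn X l j y' := by
  by_cases hl : y l ≤ z
  · have hc : IsCoverChain z β l r y := ⟨hl, h.2.1, fun t h1 h2 => h.2.2 t (by omega) h2⟩
    have e1 := optOn_le (X := X) (hc.coversOn hlr)
    have e2 := costOn_le_of_subset X y hil (le_refl r)
    have e3 := (h'.coversOn (by omega)).optOn_le_of_subset (X := X) hil (le_refl j)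
    linarith
  have a1 := h'.1
  by_cases hq : ∃ q, l ≤ q ∧ q ≤ r ∧ y q ≤ y' q
  · obtain ⟨q, hq1, hq2, hq3⟩ := hq
    obtain ⟨t, h1, h2, h3, h4⟩ := exists_cross (y := y) (y' := y') hq1 (by linarith) hq3
    exact optOn_add_optOn_le_of_cross h h' (by omega) h1 (by omega) (by omega) h3 h4
  push Not at hq hl
  -- `u` is the tightest chain starting at `0`; it reaches `β` within the sensors `l, …, r`.
  set u : ℕ → ℝ := fun t => z + 2 * z * ((t : ℝ) - l) with hu
  have hul : u l = z := by simp [hu]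
  have hur : β - z ≤ u r := by simp only [hu]; linarith
  have husucc : ∀ t, u (t + 1) = u t + 2 * z := fun t => by simp only [hu]; push_cast; ring
  have hy'u : ∀ t, l ≤ t → t ≤ j → y' t ≤ u t := by
    intro t ht
    induction t, ht using Nat.le_induction with
    | base => intro _; linarith
    | succ t ht ih =>
      intro htj
      have := ih (by omega)
      have := h'.2.2 t ht (by omega)
      linarith [husucc t]
  set v : ℕ → ℝ := fun t => min (y t) (u t) with hv
  set w : ℕ → ℝ := fun t => if t < l then y t else if t ≤ r then y t + y' t - v t else y' t
    with hw
  have hvchain : IsCoverChain z β l r v := by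
    refine ⟨(min_le_right _ _).trans hul.le, le_min h.2.1 hur, fun t h1 h2 => ?_⟩
    have := h.2.2 t (by omega) h2
    have := husucc t
    simp only [hv]
    rcases min_cases (y t) (u t) with g1 | g1 <;>
    rcases min_cases (y (t + 1)) (u (t + 1)) with g2 | g2 <;> linarith
  have hwmid : ∀ t, l ≤ t → t ≤ r → w t = y t + y' t - v t := fun t h1 h2 => by
    simp [hw, h2, not_lt.mpr h1]
  have hwleft : ∀ t, t < l → w t = y t := fun t h1 => by simp [hw, h1]
  have hwright : ∀ t, r < t → w t = y' t := fun t h1 => by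
    simp [hw, not_le.mpr h1, not_lt.mpr (hlr.trans h1.le)]
  have hvl : v l = z := by simp only [hv, hul]; exact min_eq_right hl.le
  have hvy : ∀ t, v t ≤ y t := fun t => min_le_left _ _
  have hwl : w l ≤ y l := by rw [hwmid l le_rfl hlr, hvl]; linarith
  have hwr : y' r ≤ w r := by rw [hwmid r hlr le_rfl]; linarith [hvy r]
  have hwchain : IsCoverChain z β i j w := by
    refine ⟨?_, ?_, ?_⟩
    · rcases Nat.eq_or_lt_of_le hil with rfl | hlt
      · exact hwl.trans h.1
      · rw [hwleft i hlt]
        exact h.1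
    · rcases Nat.eq_or_lt_of_le hrj with rfl | hlt
      · exact h'.2.1.trans hwr
      · rw [hwright j hlt]
        exact h'.2.1
    · intro t h1 h2
      rcases Nat.lt_or_ge t l with htl | htl
      · have := h.2.2 t h1 (by omega)
        rw [hwleft t htl]
        rcases Nat.eq_or_lt_of_le (Nat.succ_le_of_lt htl) with rfl | hlt
        · linarith
        · rw [hwleft _ hlt]
          exact this
      · have hstep' := h'.2.2 t htl h2
        rcases Nat.lt_or_ge t r with htr | htr
        · rw [hwmid t htl htr.le, hwmid (t + 1) (by omega) htr]
          have := h.2.2 t h1 htr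
          have := husucc t
          simp only [hv]
          rcases min_cases (y t) (u t) with g1 | g1 <;>
          rcases min_cases (y (t + 1)) (u (t + 1)) with g2 | g2 <;> linarith
        · rw [hwright (t + 1) (by omega)]
          rcases Nat.eq_or_lt_of_le htr with rfl | hlt
          · linarith
          · rw [hwright t hlt]
            exact hstep'
  have c1 := optOn_le (X := X) (hwchain.coversOn (by omega))
  have c2 := optOn_le (X := X) (hvchain.coversOn hlr)
  refine (add_le_add c1 c2).trans ?_
  unfold costOn
  have hN : r < j + 1 := by omega
  have hN' : j < j + 1 := by omega
  rw [sum_Icc_eq_sum_range_ite _ hN, sum_Icc_eq_sum_range_ite _ hN,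
    sum_Icc_eq_sum_range_ite _ hN', sum_Icc_eq_sum_range_ite _ hN',
    ← Finset.sum_add_distrib, ← Finset.sum_add_distrib]
  refine Finset.sum_le_sum fun t _ => ?_
  rcases Nat.lt_or_ge t l with htl | htl
  · rw [hwleft t htl]
    split_ifs <;> first | omega | linarith
  rcases Nat.lt_or_ge r t with htr | htr
  · rw [hwright t htr]
    split_ifs <;> first | omega | linarith
  · rw [hwmid t htl htr, if_pos (by omega), if_pos (by omega), if_pos (by omega),
      if_pos (by omega)]
    exact abs_sub_add_abs_sub_le_of_mem_Icc
      (le_min (hq t htl htr).le (hy'u t htl (by omega))) (hvy t)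

lemma exists_coversOn {z β : ℝ} {l r i j : ℕ} (hz : 0 < z) (hil : i ≤ l) (hlr : l ≤ r)
    (hrj : r ≤ j) (hlam : β ≤ 2 * z * ((r : ℝ) - l + 1)) : ∃ y, CoversOn z β i j y := by
  refine ⟨fun t => z + 2 * z * ((t : ℝ) - i), IsCoverChain.coversOn (by omega) ⟨?_, ?_, ?_⟩⟩
  · simp
  · have h1 : (i : ℝ) ≤ l := by exact_mod_cast hil
    have h2 : (r : ℝ) ≤ j := by exact_mod_cast hrj
    have : 2 * z * ((r : ℝ) - l + 1) ≤ 2 * z * ((j : ℝ) - i + 1) := by gcongr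
    linarith
  · intro t _ _
    push_cast
    linarith

/-- With enough inner sensors, the benefits of extra sensors on the left and on the right are
independent of each other. -/
lemma optOn_add_optOn_eq {z β : ℝ} {X : ℕ → ℝ} {n l r i j : ℕ} (hz : 0 < z) (hβ : 0 < β)
    (hX : MonotoneOn X (Set.Icc 1 n))
    (hXmem : ∀ t, 1 ≤ t → t ≤ n → X t ∈ Set.Icc (-z) (β + z))
    (hi : 1 ≤ i) (hil : i ≤ l) (hlr : l ≤ r) (hrj : r ≤ j) (hj : j ≤ n)
    (hlam : β ≤ 2 * z * ((r : ℝ) - l + 1)) :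
    optOn z β X i j + optOn z β X l r = optOn z β X i r + optOn z β X l j := by
  have hchain : ∀ {a b : ℕ} {y : ℕ → ℝ}, 1 ≤ a → a ≤ b → b ≤ n → CoversOn z β a b y →
      ∃ y', IsCoverChain z β a b y' ∧ costOn X a b y' ≤ costOn X a b y :=
    fun ha hab hb hy => hy.exists_isCoverChain hz hβ hab
      (hX.mono (Set.Icc_subset_Icc ha hb)) fun t h1 h2 => hXmem t (by omega) (by omega)
  have hne : ∀ {a b : ℕ}, a ≤ l → r ≤ b → ∃ y, CoversOn z β a b y :=
    fun ha hb => exists_coversOn hz ha hlr hb hlam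
  apply le_antisymm
  · rw [← sub_le_iff_le_add]
    refine le_optOn (hne hil le_rfl) fun y hy => ?_
    rw [sub_le_comm]
    refine le_optOn (hne le_rfl hrj) fun y' hy' => ?_
    obtain ⟨v, hv, hvc⟩ := hchain hi (by omega) (by omega) hy
    obtain ⟨v', hv', hvc'⟩ := hchain (by omega) (by omega) hj hy'
    have := optOn_add_optOn_le_of_left_right (X := X) hil hlr hrj hlam hv hv'
    linarith
  · rw [← sub_le_iff_le_add]
    refine le_optOn (hne hil hrj) fun y hy => ?_
    rw [sub_le_comm]
    refine le_optOn (hne le_rfl le_rfl) fun y' hy' => ?_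
    obtain ⟨v, hv, hvc⟩ := hchain hi (by omega) hj hy
    obtain ⟨v', hv', hvc'⟩ := hchain (by omega) hlr (by omega) hy'
    have := optOn_add_optOn_le_of_outer_inner (X := X) hil hlr hrj hv hv'
    linarith

lemma exists_smallest_minimizer (F : ℕ → ℝ) {a b : ℕ} (hab : a ≤ b) :
    ∃ m, a ≤ m ∧ m ≤ b ∧ (∀ k, a ≤ k → k ≤ b → F m ≤ F k) ∧
      ∀ k, a ≤ k → k < m → F m < F k := by
  classical
  have hex : ∃ m, a ≤ m ∧ m ≤ b ∧ ∀ k, a ≤ k → k ≤ b → F m ≤ F k := by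
    obtain ⟨m, hm, hmin⟩ := Finset.exists_min_image (Finset.Icc a b) F ⟨a, by simp [hab]⟩
    simp only [Finset.mem_Icc] at hm hmin
    exact ⟨m, hm.1, hm.2, fun k h1 h2 => hmin k ⟨h1, h2⟩⟩
  obtain ⟨h1, h2, h3⟩ := Nat.find_spec hex
  refine ⟨Nat.find hex, h1, h2, h3, fun k hk hlt => ?_⟩
  by_contra hc
  exact Nat.find_min hex hlt
    ⟨hk, by omega, fun k' g1 g2 => (not_lt.mp hc).trans (h3 k' g1 g2)⟩

lemma optCost_le_DG {n : ℕ} {z β : ℝ} {x : ℕ → ℝ} {l r i j : ℕ}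
    (hleft : ∀ t, 1 ≤ t → t < l → x t < -z) (hright : ∀ t, r < t → t ≤ n → β + z < x t)
    (hi : 1 ≤ i) (hil : i ≤ l) (hlr : l ≤ r) (hrj : r ≤ j) (hj : j ≤ n)
    (hne : ∃ y, CoversOn z β i j y) :
    OptCost n z β x ≤ DG z β x l r i j := by
  change optOn z β x 1 n ≤ _ + _ + optOn z β (XMod x l r z β) i j
  rw [← sub_le_iff_le_add']
  refine le_optOn hne fun y hy => ?_
  rw [sub_le_iff_le_add']
  refine (hy.optOn_le_of_subset (X := x) hi hj).trans ?_
  unfold costOn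
  have hN : j < n + 1 := by omega
  have hN' : l - 1 < n + 1 := by omega
  rw [sum_Icc_eq_sum_range_ite _ hN, sum_Icc_eq_sum_range_ite _ hN,
    sum_Icc_eq_sum_range_ite _ hN, sum_Icc_eq_sum_range_ite _ hN',
    ← Finset.sum_add_distrib, ← Finset.sum_add_distrib]
  refine Finset.sum_le_sum fun t _ => ?_
  simp only [XMod]
  split_ifs <;> first | omega | (simp; done) | skip
  · have := hleft t (by omega) (by omega)
    rcases abs_cases (x t - y t) with g1 | g1 <;> rcases abs_cases (-z - y t) with g2 | g2 <;>
      linarith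
  · have := hright t (by omega) (by omega)
    rcases abs_cases (x t - y t) with g1 | g1 <;> rcases abs_cases (β + z - y t) with g2 | g2 <;>
      linarith

lemma exists_DG_le_cost {n : ℕ} {z β : ℝ} {x y : ℕ → ℝ} {l r : ℕ}
    (hx : MonotoneOn x (Set.Icc 1 n))
    (hleft : ∀ t, 1 ≤ t → t < l → x t < -z) (hright : ∀ t, r < t → t ≤ n → β + z < x t)
    (hl : 1 ≤ l) (hlr : l ≤ r) (hr : r ≤ n) (hy : CoversOn z β 1 n y) :
    ∃ i j, 1 ≤ i ∧ i ≤ l ∧ r ≤ j ∧ j ≤ n ∧ DG z β x l r i j ≤ costOn x 1 n y := by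
  classical
  obtain ⟨v, hv, hvimg, hvcost⟩ := exists_monotoneOn_costOn_le n (by omega) y hx
  have hvcov := hy.of_image_eq hvimg
  obtain ⟨i, hi1, hil, hiout, hiin⟩ : ∃ i, 1 ≤ i ∧ i ≤ l ∧ (∀ t, 1 ≤ t → t < i → v t < -z) ∧
      ∀ t, i ≤ t → t < l → -z ≤ v t := by
    have hex : ∃ i, 1 ≤ i ∧ (i = l ∨ -z ≤ v i) := ⟨l, hl, Or.inl rfl⟩
    have hle : Nat.find hex ≤ l := Nat.find_min' hex ⟨hl, Or.inl rfl⟩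
    obtain ⟨h1, h2⟩ := Nat.find_spec hex
    refine ⟨Nat.find hex, h1, hle, fun t ht hlt => ?_, fun t ht hlt => ?_⟩
    · by_contra hc
      exact Nat.find_min hex hlt ⟨ht, Or.inr (not_lt.mp hc)⟩
    · rcases h2 with h2 | h2
      · omega
      · exact h2.trans (hv ⟨h1, by omega⟩ ⟨by omega, by omega⟩ ht)
  obtain ⟨j, hrj, hjn, hjout, hjin⟩ : ∃ j, r ≤ j ∧ j ≤ n ∧
      (∀ t, j < t → t ≤ n → β + z < v t) ∧ ∀ t, r < t → t ≤ j → v t ≤ β + z := by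
    have hex : ∃ j, r ≤ j ∧ (j = n ∨ β + z < v (j + 1)) := ⟨n, hr, Or.inl rfl⟩
    have hle : Nat.find hex ≤ n := Nat.find_min' hex ⟨hr, Or.inl rfl⟩
    obtain ⟨h1, h2⟩ := Nat.find_spec hex
    refine ⟨Nat.find hex, h1, hle, fun t ht hlt => ?_, fun t ht hlt => ?_⟩
    · rcases h2 with h2 | h2
      · omega
      · exact h2.trans_le (hv ⟨by omega, by omega⟩ ⟨by omega, hlt⟩ ht)
    · by_contra hc
      refine Nat.find_min hex (m := t - 1) (by omega) ⟨by omega, Or.inr ?_⟩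
      rw [Nat.sub_add_cancel (by omega)]
      exact not_le.mp hc
  refine ⟨i, j, hi1, hil, hrj, hjn, le_trans ?_ hvcost⟩
  have hcov : CoversOn z β i j v := by
    rw [coversOn_iff] at hvcov ⊢
    intro p hp hq
    obtain ⟨t, h1, h2, h3, h4⟩ := hvcov p hp hq
    refine ⟨t, ?_, ?_, h3, h4⟩
    · by_contra hc
      linarith [hiout t h1 (not_le.mp hc)]
    · by_contra hc
      linarith [hjout t (not_le.mp hc) h2]
  change _ + _ + optOn z β (XMod x l r z β) i j ≤ _
  refine (add_le_add_right (optOn_le hcov) _).trans ?_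
  unfold costOn
  have hN : j < n + 1 := by omega
  have hN' : l - 1 < n + 1 := by omega
  have hN'' : n < n + 1 := by omega
  rw [sum_Icc_eq_sum_range_ite _ hN, sum_Icc_eq_sum_range_ite _ hN,
    sum_Icc_eq_sum_range_ite _ hN', sum_Icc_eq_sum_range_ite _ hN'',
    ← Finset.sum_add_distrib, ← Finset.sum_add_distrib]
  refine Finset.sum_le_sum fun t _ => ?_
  simp only [XMod]
  split_ifs <;> first | omega | (simp; done) | skip
  · have := hleft t (by omega) (by omega)
    have := hiin t (by omega) (by omega)
    rw [abs_of_nonpos (by linarith), abs_of_nonpos (by linarith)]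
    linarith
  · have := hright t (by omega) (by omega)
    have := hjin t (by omega) (by omega)
    rw [abs_of_nonneg (by linarith), abs_of_nonneg (by linarith)]
    linarith

/-- Lemma 10: in the general case, if `r − l + 1 ≥ λ`, the row and column minimizers
of `D` are constant: there are `l* ∈ [1, l]` and `r* ∈ [r, n]` with
`D(l*, r*) = OptCost` such that for every `i ∈ [1, l]`, `r*` is the smallest index
`j ∈ [r, n]` minimizing `D(i, j)`, and for every `j ∈ [r, n]`, `l*` is the smallest
index `i ∈ [1, l]` minimizing `D(i, j)`. -/
theorem general_row_col_minimizers_constant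
    (n : ℕ) (z β : ℝ) (x : ℕ → ℝ) (l r : ℕ)
    (hn : 1 ≤ n) (hz : 0 < z) (hβ : 0 < β)
    (hsort : ∀ i, 1 ≤ i → i < n → x i ≤ x (i + 1))
    (hfeas : β ≤ 2 * z * n)
    (hl1 : 1 < l) (hrn : r < n) (hlr : l ≤ r)
    (hlmem : -z ≤ x l ∧ x l ≤ β + z)
    (hlmin : ∀ i, 1 ≤ i → i ≤ n → -z ≤ x i → x i ≤ β + z → l ≤ i)
    (hrmem : -z ≤ x r ∧ x r ≤ β + z)
    (hrmax : ∀ i, 1 ≤ i → i ≤ n → -z ≤ x i → x i ≤ β + z → i ≤ r)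
    (hlam : ⌈β / (2 * z)⌉₊ ≤ r - l + 1) :
    ∃ lstar rstar : ℕ, 1 ≤ lstar ∧ lstar ≤ l ∧ r ≤ rstar ∧ rstar ≤ n ∧
      DG z β x l r lstar rstar = OptCost n z β x ∧
      (∀ i, 1 ≤ i → i ≤ l →
        (∀ j, r ≤ j → j ≤ n → DG z β x l r i rstar ≤ DG z β x l r i j) ∧
        (∀ j, r ≤ j → j < rstar → DG z β x l r i rstar < DG z β x l r i j)) ∧
      (∀ j, r ≤ j → j ≤ n →
        (∀ i, 1 ≤ i → i ≤ l → DG z β x l r lstar j ≤ DG z β x l r i j) ∧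
        (∀ i, 1 ≤ i → i < lstar → DG z β x l r lstar j < DG z β x l r i j)) := by
  have hx : MonotoneOn x (Set.Icc 1 n) := by
    intro s hs t ht hst
    obtain ⟨hs1, -⟩ := hs
    obtain ⟨-, htn⟩ := ht
    induction t, hst using Nat.le_induction with
    | base => exact le_rfl
    | succ t hst ih => exact (ih (by omega)).trans (hsort t (by omega) (by omega))
  have hleft : ∀ t, 1 ≤ t → t < l → x t < -z := by
    intro t h1 h2
    by_contra hc
    have hle : x t ≤ x l := hx ⟨h1, by omega⟩ ⟨by omega, by omega⟩ h2.le
    have := hlmin t h1 (by omega) (not_lt.mp hc) (hle.trans hlmem.2)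
    omega
  have hright : ∀ t, r < t → t ≤ n → β + z < x t := by
    intro t h1 h2
    by_contra hc
    have hle : x r ≤ x t := hx ⟨by omega, by omega⟩ ⟨by omega, h2⟩ h1.le
    have := hrmax t (by omega) h2 (hrmem.1.trans hle) (not_lt.mp hc)
    omega
  have hmid : ∀ t, l ≤ t → t ≤ r → -z ≤ x t ∧ x t ≤ β + z := fun t h1 h2 =>
    ⟨hlmem.1.trans (hx ⟨by omega, by omega⟩ ⟨by omega, by omega⟩ h1),
      (hx ⟨by omega, by omega⟩ ⟨by omega, by omega⟩ h2).trans hrmem.2⟩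
  have hXmem : ∀ t, 1 ≤ t → t ≤ n → XMod x l r z β t ∈ Set.Icc (-z) (β + z) := by
    intro t h1 h2
    simp only [XMod]
    split_ifs
    · exact ⟨le_rfl, by linarith⟩
    · exact hmid t (by omega) (by omega)
    · exact ⟨by linarith, le_rfl⟩
  have hX : MonotoneOn (XMod x l r z β) (Set.Icc 1 n) := by
    intro s hs t ht hst
    by_cases hsl : s < l
    · have e : XMod x l r z β s = -z := by simp [XMod, hsl]
      rw [e]
      exact (hXmem t ht.1 ht.2).1
    by_cases htr : t ≤ r
    · have e : XMod x l r z β s = x s := by simp [XMod, hsl, hst.trans htr]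
      have e' : XMod x l r z β t = x t := by simp [XMod, htr, show ¬ t < l by omega]
      rw [e, e']
      exact hx hs ht hst
    · have e : XMod x l r z β t = β + z := by simp [XMod, htr, show ¬ t < l by omega]
      rw [e]
      exact (hXmem s hs.1 hs.2).2
  have hlen : β ≤ 2 * z * ((r : ℝ) - l + 1) := by
    have h1 := Nat.ceil_le.mp hlam
    rw [div_le_iff₀ (by positivity)] at h1
    push_cast [Nat.cast_sub hlr] at h1
    linarith
  set F : ℕ → ℝ := fun i =>
    ∑ t ∈ Finset.Icc i (l - 1), (-z - x t) + optOn z β (XMod x l r z β) i r with hF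
  set G : ℕ → ℝ := fun j => ∑ t ∈ Finset.Icc (r + 1) j, (x t - z - β) +
    optOn z β (XMod x l r z β) l j - optOn z β (XMod x l r z β) l r with hG
  have hD : ∀ i j, 1 ≤ i → i ≤ l → r ≤ j → j ≤ n → DG z β x l r i j = F i + G j := by
    intro i j h1 h2 h3 h4
    have := optOn_add_optOn_eq hz hβ hX hXmem h1 h2 hlr h3 h4 hlen
    change _ + _ + optOn z β (XMod x l r z β) i j = _
    simp only [hF, hG]
    linarith
  obtain ⟨a, ha1, hal, hamin, halt⟩ := exists_smallest_minimizer F hl1.le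
  obtain ⟨b, hrb, hbn, hbmin, hblt⟩ := exists_smallest_minimizer G hrn.le
  refine ⟨a, b, ha1, hal, hrb, hbn, ?_, ?_, ?_⟩
  · apply le_antisymm
    · change _ ≤ optOn z β x 1 n
      refine le_optOn (exists_coversOn hz hl1.le hlr hrn.le hlen) fun y hy => ?_
      obtain ⟨i, j, h1, h2, h3, h4, h5⟩ :=
        exists_DG_le_cost hx hleft hright hl1.le hlr hrn.le hy
      refine le_trans ?_ h5
      rw [hD a b ha1 hal hrb hbn, hD i j h1 h2 h3 h4]
      exact add_le_add (hamin i h1 h2) (hbmin j h3 h4)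
    · exact optCost_le_DG hleft hright ha1 hal hlr hrb hbn (exists_coversOn hz hal hlr hrb hlen)
  · intro i h1 h2
    refine ⟨fun j h3 h4 => ?_, fun j h3 h4 => ?_⟩
    · rw [hD i b h1 h2 hrb hbn, hD i j h1 h2 h3 h4]
      linarith [hbmin j h3 h4]
    · rw [hD i b h1 h2 hrb hbn, hD i j h1 h2 h3 (by omega)]
      linarith [hblt j h3 h4]
  · intro j h1 h2
    refine ⟨fun i h3 h4 => ?_, fun i h3 h4 => ?_⟩
    · rw [hD a j ha1 hal h1 h2, hD i j h3 h4 h1 h2]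
      linarith [hamin i h3 h4]
    · rw [hD a j ha1 hal h1 h2, hD i j h3 (by omega) h1 h2]
      linarith [halt i h3 h4]
end

section
/- Explicit optimum when all sensor intervals lie strictly to the right of the barrier (Lemma 2 of the paper): assume β < x_1 − z and m := ⌈β/(2z)⌉ ≤ n. Then the configuration y* defined by y*_i := (2i − 1)z for 1 ≤ i ≤ m and y*_i := x_i for m < i ≤ n covers the barrier (sensors 1, …, m are in attached positions with the first interval's left endpoint at 0 and all other sensors unmoved), and its cost Σ_{i=1}^m (x_i − (2i − 1)z) is less than or equal to the cost of every covering configuration; hence OptCost = Σ_{i=1}^m (x_i − (2i − 1)z). -/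
/-- A compact interval `[0, T]` covered by finitely many intervals of length `2 * z` has length at
most `2 * z` times their number. -/
theorem le_card_mul_of_Icc_subset_biUnion {z T : ℝ} (hz : 0 < z) {y : ℕ → ℝ} {A : Finset ℕ}
    (h : Set.Icc 0 T ⊆ ⋃ i ∈ A, Set.Icc (y i - z) (y i + z)) :
    T ≤ A.card * (2 * z) := by
  have hvol : MeasureTheory.volume (Set.Icc 0 T) ≤ ENNReal.ofReal (A.card * (2 * z)) := by
    calc MeasureTheory.volume (Set.Icc 0 T)
        ≤ MeasureTheory.volume (⋃ i ∈ A, Set.Icc (y i - z) (y i + z)) :=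
          MeasureTheory.measure_mono h
      _ ≤ ∑ i ∈ A, MeasureTheory.volume (Set.Icc (y i - z) (y i + z)) :=
          MeasureTheory.measure_biUnion_finset_le _ _
      _ = ∑ i ∈ A, ENNReal.ofReal (2 * z) := by
          refine Finset.sum_congr rfl fun i _ => ?_
          rw [Real.volume_Icc]
          congr 1
          ring
      _ = ENNReal.ofReal (A.card * (2 * z)) := by
          rw [Finset.sum_const, nsmul_eq_mul, ENNReal.ofReal_mul (Nat.cast_nonneg _),
            ENNReal.ofReal_natCast]
  rw [Real.volume_Icc, sub_zero] at hvol
  exact (ENNReal.ofReal_le_ofReal_iff (by positivity)).1 hvol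

/-- In a covering configuration, at least `k + 1` sensors are centred at or to the left of
`(2 * k + 1) * z`, as long as `2 * k * z < β`. -/
theorem Covers.lt_card_filter_le {n k : ℕ} {z β : ℝ} {y : ℕ → ℝ} (hz : 0 < z)
    (hy : Covers n z β y) (hk : 2 * k * z < β) :
    k < ((Finset.Icc 1 n).filter fun i => y i ≤ (2 * k + 1) * z).card := by
  set A := (Finset.Icc 1 n).filter fun i => y i ≤ (2 * k + 1) * z
  have hright : ∀ᶠ T in nhdsWithin (2 * k * z) (Set.Ioi (2 * k * z)),
      ∀ i ∈ (Finset.Icc 1 n).filter fun i => ¬ y i ≤ (2 * k + 1) * z, T < y i - z := by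
    rw [Finset.eventually_all]
    intro i hi
    have hi' := (Finset.mem_filter.1 hi).2
    exact mem_nhdsWithin_of_mem_nhds (Iio_mem_nhds (by linarith))
  have hβ : ∀ᶠ T in nhdsWithin (2 * k * z) (Set.Ioi (2 * k * z)), T < β :=
    mem_nhdsWithin_of_mem_nhds (Iio_mem_nhds hk)
  obtain ⟨T, hT, hTβ, hkT⟩ := (hright.and (hβ.and self_mem_nhdsWithin)).exists
  have hcov : Set.Icc 0 T ⊆ ⋃ i ∈ A, Set.Icc (y i - z) (y i + z) := by
    intro t ht
    have hmem := hy ⟨ht.1, ht.2.trans hTβ.le⟩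
    simp only [Set.mem_iUnion] at hmem ⊢
    obtain ⟨i, hi, hti⟩ := hmem
    refine ⟨i, ?_, hti⟩
    by_contra hiA
    have := hT i (Finset.mem_filter.2 ⟨hi, fun h => hiA (Finset.mem_filter.2 ⟨hi, h⟩)⟩)
    linarith [hti.1, ht.2]
  have hle := le_card_mul_of_Icc_subset_biUnion hz hcov
  have hkT' : 2 * k * z < T := hkT
  by_contra! hcard
  have hcard' : (A.card : ℝ) ≤ k := by exact_mod_cast hcard
  nlinarith

/-- In a covering configuration one can select `k` sensors whose centres sum to at most
`z + 3 * z + ⋯ + (2 * k - 1) * z`. -/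
theorem Covers.exists_card_eq_sum_le {n : ℕ} {z β : ℝ} {y : ℕ → ℝ} (hz : 0 < z)
    (hy : Covers n z β y) (k : ℕ) (hk : k ≤ ⌈β / (2 * z)⌉₊) :
    ∃ S ⊆ Finset.Icc 1 n, S.card = k ∧
      ∑ i ∈ S, y i ≤ ∑ j ∈ Finset.Icc 1 k, (2 * (j : ℝ) - 1) * z := by
  induction k with
  | zero => exact ⟨∅, by simp⟩
  | succ k ih =>
    obtain ⟨S, hSn, hScard, hSsum⟩ := ih (by omega)
    have hkβ : 2 * k * z < β := by
      have := Nat.lt_ceil.1 (Nat.lt_of_succ_le hk)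
      rw [lt_div_iff₀ (by positivity)] at this
      linarith
    obtain ⟨a, ha, haS⟩ := Finset.exists_mem_notMem_of_card_lt_card
      (hScard.trans_lt (hy.lt_card_filter_le hz hkβ))
    obtain ⟨han, hya⟩ := Finset.mem_filter.1 ha
    refine ⟨insert a S, Finset.insert_subset han hSn, ?_, ?_⟩
    · rw [Finset.card_insert_of_notMem haS, hScard]
    · rw [Finset.sum_insert haS, Finset.sum_Icc_succ_top (by omega)]
      push_cast
      linarith

/-- The first `k` terms of a finite nondecreasing sequence have the least sum among all
selections of `k` terms. -/
theorem sum_Icc_le_sum_of_card_eq {n : ℕ} {x : ℕ → ℝ} (hx : MonotoneOn x (Set.Icc 1 n))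
    (k : ℕ) (S : Finset ℕ) (hS : S ⊆ Finset.Icc 1 n) (hcard : S.card = k) :
    ∑ i ∈ Finset.Icc 1 k, x i ≤ ∑ i ∈ S, x i := by
  induction k generalizing S with
  | zero => simp [Finset.card_eq_zero.1 hcard]
  | succ k ih =>
    have hne : S.Nonempty := Finset.card_pos.1 (by omega)
    have hmax := S.max'_mem hne
    have hmax' := Finset.mem_Icc.1 (hS hmax)
    have hle : k + 1 ≤ S.max' hne := by
      have hsub : S ⊆ Finset.Icc 1 (S.max' hne) := fun i hi =>
        Finset.mem_Icc.2 ⟨(Finset.mem_Icc.1 (hS hi)).1, S.le_max' i hi⟩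
      simpa [hcard] using Finset.card_le_card hsub
    rw [Finset.sum_Icc_succ_top (by omega), ← Finset.sum_erase_add S x hmax]
    refine add_le_add (ih _ ((Finset.erase_subset _ _).trans hS) ?_)
      (hx ⟨by omega, hle.trans hmax'.2⟩ hmax' hle)
    rw [Finset.card_erase_of_mem hmax, hcard, Nat.add_sub_cancel]

/-- Sensors attached one after the other, starting at the left end of the barrier, cover it. -/
theorem covers_attached {n : ℕ} {z β : ℝ} (x : ℕ → ℝ) (hz : 0 < z) (hβ : 0 < β)
    (hlam : ⌈β / (2 * z)⌉₊ ≤ n) :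
    Covers n z β
      (fun i => if i ≤ ⌈β / (2 * z)⌉₊ then (2 * (i : ℝ) - 1) * z else x i) := by
  intro t ht
  have hz2 : 0 < 2 * z := by positivity
  have hm : 1 ≤ ⌈β / (2 * z)⌉₊ := Nat.ceil_pos.2 (by positivity)
  obtain ⟨i, hi1, him, hlow, hupp⟩ : ∃ i : ℕ, 1 ≤ i ∧ i ≤ ⌈β / (2 * z)⌉₊ ∧
      (2 * (i : ℝ) - 2) * z ≤ t ∧ t ≤ 2 * i * z := by
    rcases ht.1.eq_or_lt with rfl | htpos
    · exact ⟨1, le_rfl, hm, by norm_num, by norm_num; exact hz.le⟩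
    · have hdiv : 0 < t / (2 * z) := by positivity
      refine ⟨⌈t / (2 * z)⌉₊, Nat.ceil_pos.2 hdiv,
        Nat.ceil_mono (div_le_div_of_nonneg_right ht.2 hz2.le), ?_, ?_⟩
      · have h := Nat.ceil_lt_add_one hdiv.le
        rw [← sub_lt_iff_lt_add, lt_div_iff₀ hz2] at h
        linarith
      · have h := Nat.le_ceil (t / (2 * z))
        rw [div_le_iff₀ hz2] at h
        linarith
  simp only [Set.mem_iUnion]
  refine ⟨i, Finset.mem_Icc.2 ⟨hi1, him.trans hlam⟩, ?_⟩
  rw [if_pos him]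
  constructor <;> linarith

/-- Lemma 2: if all sensor intervals lie strictly to the right of the barrier and
`m = ⌈β/(2z)⌉ ≤ n`, then moving sensors `1, …, m` into attached positions with the
first interval's left endpoint at `0` (i.e. `y*_i = (2i−1)z`) and leaving the rest
unmoved is an optimal covering configuration, of cost `Σ_{i=1}^m (x_i − (2i−1)z)`. -/
theorem all_right_explicit_optimum
    (n : ℕ) (z β : ℝ) (x : ℕ → ℝ)
    (hn : 1 ≤ n) (hz : 0 < z) (hβ : 0 < β)
    (hsort : ∀ i, 1 ≤ i → i < n → x i ≤ x (i + 1))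
    (hright : β < x 1 - z)
    (hlam : ⌈β / (2 * z)⌉₊ ≤ n) :
    Covers n z β
      (fun i => if i ≤ ⌈β / (2 * z)⌉₊ then (2 * (i : ℝ) - 1) * z else x i) ∧
    Cost n x (fun i => if i ≤ ⌈β / (2 * z)⌉₊ then (2 * (i : ℝ) - 1) * z else x i) =
      ∑ i ∈ Finset.Icc 1 ⌈β / (2 * z)⌉₊, (x i - (2 * (i : ℝ) - 1) * z) ∧
    (∀ y : ℕ → ℝ, Covers n z β y →
      Cost n x (fun i => if i ≤ ⌈β / (2 * z)⌉₊ then (2 * (i : ℝ) - 1) * z else x i) ≤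
        Cost n x y) ∧
    OptCost n z β x = ∑ i ∈ Finset.Icc 1 ⌈β / (2 * z)⌉₊, (x i - (2 * (i : ℝ) - 1) * z) := by
  have hmono : MonotoneOn x (Set.Icc 1 n) := by
    intro a ha b hb hab
    induction b, hab using Nat.le_induction with
    | base => exact le_rfl
    | succ b hab ih =>
      have h1b : 1 ≤ b := ha.1.trans hab
      have hbn : b < n := hb.2
      exact (ih ⟨h1b, hbn.le⟩).trans (hsort b h1b hbn)
  have hcov := covers_attached x hz hβ hlam
  have hcost : Cost n x
      (fun i => if i ≤ ⌈β / (2 * z)⌉₊ then (2 * (i : ℝ) - 1) * z else x i) =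
      ∑ i ∈ Finset.Icc 1 ⌈β / (2 * z)⌉₊, (x i - (2 * (i : ℝ) - 1) * z) := by
    unfold Cost
    symm
    refine Finset.sum_subset_zero_on_sdiff (Finset.Icc_subset_Icc_right hlam) ?_ ?_
    · intro i hi
      simp only [Finset.mem_sdiff, Finset.mem_Icc] at hi
      have him : ¬ i ≤ ⌈β / (2 * z)⌉₊ := by omega
      simp only [if_neg him, sub_self, abs_zero]
    · intro i hi
      obtain ⟨hi1, him⟩ := Finset.mem_Icc.1 hi
      have hx1 : x 1 ≤ x i := hmono ⟨le_rfl, hn⟩ ⟨hi1, him.trans hlam⟩ hi1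
      have hceil := Nat.ceil_lt_add_one (show 0 ≤ β / (2 * z) by positivity)
      have hiβ : (i : ℝ) - 1 < β / (2 * z) := by
        have : (i : ℝ) ≤ ⌈β / (2 * z)⌉₊ := by exact_mod_cast him
        linarith
      rw [lt_div_iff₀ (by positivity)] at hiβ
      simp only [if_pos him]
      rw [abs_of_nonneg (by linarith)]
  have hopt : ∀ y : ℕ → ℝ, Covers n z β y →
      Cost n x (fun i => if i ≤ ⌈β / (2 * z)⌉₊ then (2 * (i : ℝ) - 1) * z else x i) ≤
        Cost n x y := by
    intro y hy
    obtain ⟨S, hSn, hScard, hSsum⟩ := hy.exists_card_eq_sum_le hz _ le_rfl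
    have hxS := sum_Icc_le_sum_of_card_eq hmono _ S hSn hScard
    calc Cost n x (fun i => if i ≤ ⌈β / (2 * z)⌉₊ then (2 * (i : ℝ) - 1) * z else x i)
        ≤ ∑ i ∈ S, (x i - y i) := by
          rw [hcost, Finset.sum_sub_distrib, Finset.sum_sub_distrib]
          exact sub_le_sub hxS hSsum
      _ ≤ ∑ i ∈ S, |x i - y i| := Finset.sum_le_sum fun i _ => le_abs_self _
      _ ≤ Cost n x y :=
          Finset.sum_le_sum_of_subset_of_nonneg hSn fun i _ _ => abs_nonneg _
  refine ⟨hcov, hcost, hopt, ?_⟩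
  rw [← hcost]
  refine IsLeast.csInf_eq ⟨⟨_, hcov, rfl⟩, ?_⟩
  rintro c ⟨y, hy, rfl⟩
  exact hopt y hy
end

section
/- Rigidity of exact covers by equal intervals (the key fact behind the paper's Ω(n log n) lower-bound reduction): let z > 0, let n ≥ 1, and let c_1, …, c_n be reals such that [0, 2nz] ⊆ ⋃_{i=1}^n [c_i − z, c_i + z]. Then there is a permutation σ of {1, …, n} such that c_{σ(i)} = (2i − 1)z for every i; i.e., the n intervals must be in attached positions exactly tiling [0, 2nz], with centers z, 3z, …, (2n − 1)z. -/
/-- If `n` closed intervals of length `2z` cover `(a, a + 2nz]`, then every one of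
`a + z, a + 3z, …, a + (2n - 1)z` is the center of one of them. -/
lemma exists_center_eq_of_Ioc_subset {ι : Type*} {z : ℝ} (hz : 0 < z) (c : ι → ℝ) (n : ℕ)
    (a : ℝ) (S : Finset ι) (hS : S.card = n)
    (hcov : Set.Ioc a (a + 2 * n * z) ⊆ ⋃ i ∈ S, Set.Icc (c i - z) (c i + z)) :
    ∀ k < n, ∃ i ∈ S, c i = a + (2 * k + 1) * z := by
  classical
  induction n generalizing a S with
  | zero => simp
  | succ n ih =>
    push_cast at hcov
    have hnz : 0 ≤ n * z := by positivity
    have hlt : a < a + 2 * (n + 1) * z := by linarith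
    have hclosed : IsClosed (⋃ i ∈ S, Set.Icc (c i - z) (c i + z)) :=
      S.finite_toSet.isClosed_biUnion fun _ _ => isClosed_Icc
    have ha : a ∈ ⋃ i ∈ S, Set.Icc (c i - z) (c i + z) :=
      closure_minimal hcov hclosed (by
        rw [closure_Ioc hlt.ne]
        exact Set.left_mem_Icc.2 hlt.le)
    simp only [Set.mem_iUnion, exists_prop] at ha
    obtain ⟨j, hjS, hj, -⟩ := ha
    have hrest := ih (a + 2 * z) (S.erase j) (by rw [Finset.card_erase_of_mem hjS, hS]; simp) (by
      intro x hx
      have hx' := hcov (show x ∈ Set.Ioc a (a + 2 * (n + 1) * z) from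
        ⟨by linarith [hx.1], by linarith [hx.2]⟩)
      simp only [Set.mem_iUnion, exists_prop] at hx' ⊢
      obtain ⟨i, hiS, hi⟩ := hx'
      refine ⟨i, Finset.mem_erase.2 ⟨?_, hiS⟩, hi⟩
      rintro rfl
      linarith [hx.1, hi.2])
    -- The remaining intervals are exactly the `n` ones found in `hrest`.
    have hfar : ∀ i ∈ S.erase j, a + 3 * z ≤ c i := by
      have : Nonempty ι := ⟨j⟩
      choose! f hfS hf using hrest
      have hinj : Set.InjOn f (Finset.range n) := by
        intro k hk l hl hkl
        have h := hf k (by simpa using hk)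
        rw [hkl, hf l (by simpa using hl)] at h
        have h' := mul_right_cancel₀ hz.ne' (add_left_cancel h)
        exact_mod_cast (by linarith : (k : ℝ) = l)
      have hsurj := Finset.surjOn_of_injOn_of_card_le (t := S.erase j) f
        (fun k hk => hfS k (by simpa using hk)) hinj
        (by rw [Finset.card_erase_of_mem hjS, hS]; simp)
      intro i hi
      obtain ⟨k, hk, rfl⟩ := hsurj hi
      rw [hf k (by simpa using hk)]
      have : 0 ≤ k * z := by positivity
      linarith
    have hjc : c j = a + z := by
      refine le_antisymm (by linarith) (not_lt.1 fun hlt' => ?_)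
      obtain ⟨x, hx, hx2⟩ := exists_between
        (max_lt (by linarith) (by linarith) : max a (c j + z) < a + 2 * z)
      obtain ⟨hxa, hxj⟩ := max_lt_iff.1 hx
      have hx' := hcov (show x ∈ Set.Ioc a (a + 2 * (n + 1) * z) from ⟨hxa, by linarith⟩)
      simp only [Set.mem_iUnion, exists_prop] at hx'
      obtain ⟨i, hiS, hi⟩ := hx'
      by_cases hij : i = j
      · subst hij
        linarith [hi.2]
      · linarith [hfar i (Finset.mem_erase.2 ⟨hij, hiS⟩), hi.1]
    rintro (_ | k) hk
    · exact ⟨j, hjS, by rw [hjc]; simp⟩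
    · obtain ⟨i, hi, hic⟩ := hrest k (by lia)
      refine ⟨i, Finset.mem_of_mem_erase hi, ?_⟩
      rw [hic]
      push_cast
      ring


/-- Rigidity of exact covers by equal intervals: if `n` closed intervals of length
`2z` with centers `c_1, …, c_n` cover `[0, 2nz]`, then after a permutation the
centers are exactly `z, 3z, …, (2n−1)z`, i.e. the intervals are in attached
positions exactly tiling `[0, 2nz]`. -/
theorem exact_cover_rigidity
    (z : ℝ) (n : ℕ) (c : ℕ → ℝ)
    (hz : 0 < z) (hn : 1 ≤ n)
    (hcov : Set.Icc (0 : ℝ) (2 * n * z) ⊆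
      ⋃ i ∈ Finset.Icc 1 n, Set.Icc (c i - z) (c i + z)) :
    ∃ σ : Equiv.Perm ℕ,
      (∀ i ∈ Finset.Icc 1 n, σ i ∈ Finset.Icc 1 n) ∧
      (∀ i ∈ Finset.Icc 1 n, c (σ i) = (2 * (i : ℝ) - 1) * z) := by
  have hcenter : ∀ i : Finset.Icc 1 n, ∃ j : Finset.Icc 1 n,
      c j = (2 * ((i : ℕ) : ℝ) - 1) * z := by
    rintro ⟨i, hi⟩
    obtain ⟨hi1, hin⟩ := Finset.mem_Icc.1 hi
    obtain ⟨j, hj, hjc⟩ := exists_center_eq_of_Ioc_subset hz c n 0 (Finset.Icc 1 n) (by simp)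
      (by rw [zero_add]; exact Set.Ioc_subset_Icc_self.trans hcov) (i - 1) (by lia)
    refine ⟨⟨j, hj⟩, ?_⟩
    rw [hjc]
    push_cast [hi1]
    ring
  choose f hf using hcenter
  have hinj : Function.Injective f := by
    intro i j hij
    have h := hf i
    rw [hij, hf j] at h
    have h' := mul_right_cancel₀ hz.ne' h
    exact Subtype.ext (by exact_mod_cast (by linarith : ((i : ℕ) : ℝ) = (j : ℕ)))
  let e : Equiv.Perm (Finset.Icc 1 n) := Equiv.ofBijective f (Finite.injective_iff_bijective.1 hinj)
  have hσ : ∀ i (hi : i ∈ Finset.Icc 1 n), Equiv.Perm.ofSubtype e i = f ⟨i, hi⟩ :=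
    fun i hi => Equiv.Perm.ofSubtype_apply_of_mem e hi
  refine ⟨Equiv.Perm.ofSubtype e, fun i hi => ?_, fun i hi => ?_⟩
  · rw [hσ i hi]
    exact (f ⟨i, hi⟩).2
  · rw [hσ i hi]
    exact hf ⟨i, hi⟩
end
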